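/- Let S_7, S_8 > 0, S_9 ∈ ℝ, r_v > 0, and define R_eff(α) = S_7 · exp( −S_8 (1−α)/α · 2^{r_v/(1−α) − 1} − S_9 ) for α ∈ (0,1). Then dR_eff/dα(α) = 0 if and only if α = α† := 1/(ln 2 · r_v + 1); moreover dR_eff/dα > 0 on (0, α†) and dR_eff/dα < 0 on (α†, 1), so R_eff attains its unique maximum on (0,1) at α† = 1/(ln 2 · r_v + 1). -/

import Mathlib

open Real

/-- The derivative of `a ↦ S₇ exp(-S₈ (1 - a) / a · 2 ^ (r / (1 - a) - 1) - S₉)` on `(0, 1)`,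
written as a positive factor times `1 - a (r log 2 + 1)`. -/
theorem hasDerivAt_effectiveRate (S7 S8 S9 r : ℝ) {a : ℝ} (ha0 : a ≠ 0) (ha1 : 1 - a ≠ 0) :
    HasDerivAt
      (fun a : ℝ => S7 * Real.exp (-S8 * (1 - a) / a * (2 : ℝ) ^ (r / (1 - a) - 1) - S9))
      (S7 * Real.exp (-S8 * (1 - a) / a * (2 : ℝ) ^ (r / (1 - a) - 1) - S9) *
        (S8 * (2 : ℝ) ^ (r / (1 - a) - 1) / (a ^ 2 * (1 - a))) *
        (1 - a * (Real.log 2 * r + 1))) a := by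
  have hsub : HasDerivAt (fun x : ℝ => 1 - x) (-1) a := (hasDerivAt_id a).const_sub 1
  have hexponent : HasDerivAt (fun x : ℝ => r / (1 - x) - 1) (r / (1 - a) ^ 2) a := by
    refine (((hasDerivAt_const a r).div hsub ha1).sub_const 1).congr_deriv ?_
    ring
  have hpow := hexponent.const_rpow (two_pos : (0 : ℝ) < 2)
  have hquot := (hsub.const_mul (-S8)).div (hasDerivAt_id a) ha0
  refine ((((hquot.mul hpow).sub_const S9).exp).const_mul S7).congr_deriv ?_
  simp only [id, Pi.mul_apply, Pi.div_apply]
  generalize (2 : ℝ) ^ (r / (1 - a) - 1) = p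
  generalize Real.exp _ = e
  field_simp
  ring

/-- Theorem 4: for `R_eff(α) = S₇·exp(−S₈(1−α)/α·2^{r_v/(1−α)−1} − S₉)` on `(0,1)`,
the derivative vanishes iff `α = α† = 1/(ln 2·r_v + 1)`; it is positive on `(0, α†)`,
negative on `(α†, 1)`, and `R_eff` attains its unique maximum on `(0,1)` at `α†`. -/
theorem stmt_14 (S7 S8 S9 rv : ℝ) (hS7 : 0 < S7) (hS8 : 0 < S8) (hrv : 0 < rv)
    (Reff : ℝ → ℝ)
    (hReff : Reff = fun a : ℝ =>
      S7 * Real.exp (-S8 * (1 - a) / a * (2 : ℝ) ^ (rv / (1 - a) - 1) - S9))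
    (αd : ℝ) (hαd : αd = 1 / (Real.log 2 * rv + 1)) :
    (∀ α ∈ Set.Ioo (0 : ℝ) 1, (deriv Reff α = 0 ↔ α = αd)) ∧
    (∀ α ∈ Set.Ioo (0 : ℝ) αd, 0 < deriv Reff α) ∧
    (∀ α ∈ Set.Ioo αd 1, deriv Reff α < 0) ∧
    (αd ∈ Set.Ioo (0 : ℝ) 1 ∧ ∀ α ∈ Set.Ioo (0 : ℝ) 1, α ≠ αd → Reff α < Reff αd) := by
  have hc : 0 < Real.log 2 * rv := mul_pos (Real.log_pos one_lt_two) hrv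
  have hαd0 : 0 < αd := by rw [hαd]; positivity
  have hαd1 : αd < 1 := by rw [hαd, div_lt_one (by positivity)]; linarith
  have hcrit : αd * (Real.log 2 * rv + 1) = 1 := by rw [hαd]; field_simp
  have hderiv : ∀ α ∈ Set.Ioo (0 : ℝ) 1, ∃ k > 0,
      HasDerivAt Reff (k * (αd - α)) α := by
    rintro α ⟨h0, h1⟩
    have h1' : 0 < 1 - α := sub_pos.2 h1
    rw [hReff]
    refine ⟨_, ?_, (hasDerivAt_effectiveRate S7 S8 S9 rv h0.ne' h1'.ne').congr_deriv
      (?_ : _ = S7 * Real.exp (-S8 * (1 - α) / α * (2 : ℝ) ^ (rv / (1 - α) - 1) - S9) *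
        (S8 * (2 : ℝ) ^ (rv / (1 - α) - 1) / (α ^ 2 * (1 - α))) *
        (Real.log 2 * rv + 1) * (αd - α))⟩
    · positivity
    · have hfactor : 1 - α * (Real.log 2 * rv + 1) = (Real.log 2 * rv + 1) * (αd - α) := by
        linarith
      rw [hfactor]
      ring
  have hpos : ∀ α ∈ Set.Ioo (0 : ℝ) αd, 0 < deriv Reff α := by
    rintro α ⟨h0, h1⟩
    obtain ⟨k, hk, hd⟩ := hderiv α ⟨h0, h1.trans hαd1⟩
    rw [hd.deriv]
    exact mul_pos hk (sub_pos.2 h1)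
  have hneg : ∀ α ∈ Set.Ioo αd 1, deriv Reff α < 0 := by
    rintro α ⟨h0, h1⟩
    obtain ⟨k, hk, hd⟩ := hderiv α ⟨hαd0.trans h0, h1⟩
    rw [hd.deriv]
    exact mul_neg_of_pos_of_neg hk (sub_neg.2 h0)
  have hcont : ContinuousOn Reff (Set.Ioo 0 1) := fun α hα =>
    let ⟨_, _, hd⟩ := hderiv α hα
    hd.continuousAt.continuousWithinAt
  refine ⟨fun α hα => ?_, hpos, hneg, ⟨hαd0, hαd1⟩, fun α hα hne => ?_⟩
  · obtain ⟨k, hk, hd⟩ := hderiv α hα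
    rw [hd.deriv, mul_eq_zero, or_iff_right hk.ne', sub_eq_zero, eq_comm]
  · rcases hne.lt_or_gt with h | h
    · have hmono : StrictMonoOn Reff (Set.Ioc 0 αd) :=
        strictMonoOn_of_deriv_pos (convex_Ioc 0 αd)
          (hcont.mono fun x hx => ⟨hx.1, hx.2.trans_lt hαd1⟩)
          (by rwa [interior_Ioc])
      exact hmono ⟨hα.1, h.le⟩ ⟨hαd0, le_rfl⟩ h
    · have hanti : StrictAntiOn Reff (Set.Ico αd 1) :=
        strictAntiOn_of_deriv_neg (convex_Ico αd 1)
          (hcont.mono fun x hx => ⟨hαd0.trans_le hx.1, hx.2⟩)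
          (by rwa [interior_Ico])
      exact hanti ⟨le_rfl, hαd1⟩ ⟨h.le, hα.2⟩ h
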